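/- arXiv:0904.2051 — 11 statements merged into one kernel-verified Lean document; each statement's English description precedes it below -/
import Mathlib

section
/- Let A be a real m×n matrix and let I ⊆ {1,…,n} be a fixed index set. Then every vector x0 ∈ ℝ^n with support(x0) ⊆ I is the unique minimizer of ‖x‖₁ over {x ∈ ℝ^n : Ax = Ax0} if and only if every nonzero z in the kernel of A satisfies ∑_{j∈I} |z_j| < ∑_{j∉I} |z_j|. -/
open Matrix Finset

/-- Null-space characterization of uniform recovery by basis pursuit
(Donoho–Elad, Gribonval–Nielsen). -/
theorem l1_uniform_recovery_iff_nullspace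
    (m n : ℕ) (A : Matrix (Fin m) (Fin n) ℝ) (I : Finset (Fin n)) :
    (∀ x0 : Fin n → ℝ, (∀ j, j ∉ I → x0 j = 0) →
      ∀ x : Fin n → ℝ, A.mulVec x = A.mulVec x0 → x ≠ x0 →
        ∑ j, |x0 j| < ∑ j, |x j|) ↔
    (∀ z : Fin n → ℝ, A.mulVec z = 0 → z ≠ 0 →
      ∑ j ∈ I, |z j| < ∑ j ∈ Iᶜ, |z j|) := by
  constructor
  · intro h z hz hz0
    have hlt := h (fun j => if j ∈ I then z j else 0) (fun j hj => if_neg hj)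
      ((fun j => if j ∈ I then z j else 0) - z) (by rw [mulVec_sub, hz, sub_zero])
      (by simpa using hz0)
    rw [← sum_add_sum_compl I, ← sum_add_sum_compl I (fun j => |(_ - z) j|)] at hlt
    have hI : ∑ j ∈ I, |if j ∈ I then z j else 0| = ∑ j ∈ I, |z j| :=
      sum_congr rfl fun j hj => by rw [if_pos hj]
    have hIc : ∑ j ∈ Iᶜ, |if j ∈ I then z j else 0| = 0 :=
      sum_eq_zero fun j hj => by rw [if_neg (mem_compl.1 hj), abs_zero]
    have hI' : ∑ j ∈ I, |((fun j => if j ∈ I then z j else 0) - z) j| = 0 :=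
      sum_eq_zero fun j hj => by simp [hj]
    have hIc' : ∑ j ∈ Iᶜ, |((fun j => if j ∈ I then z j else 0) - z) j| = ∑ j ∈ Iᶜ, |z j| :=
      sum_congr rfl fun j hj => by simp [mem_compl.1 hj]
    linarith
  · intro h x0 hx0 x hx hne
    have hlt := h (x - x0) (by rw [mulVec_sub, hx, sub_self]) (sub_ne_zero.2 hne)
    rw [← sum_add_sum_compl I, ← sum_add_sum_compl I (fun j => |x j|)]
    have hIc : ∑ j ∈ Iᶜ, |x0 j| = 0 :=
      sum_eq_zero fun j hj => by rw [hx0 j (mem_compl.1 hj), abs_zero]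
    have hIc' : ∑ j ∈ Iᶜ, |(x - x0) j| = ∑ j ∈ Iᶜ, |x j| :=
      sum_congr rfl fun j hj => by simp [hx0 j (mem_compl.1 hj)]
    have hI : ∑ j ∈ I, |x0 j| ≤ ∑ j ∈ I, |x j| + ∑ j ∈ I, |(x - x0) j| := by
      rw [← sum_add_distrib]
      refine sum_le_sum fun j _ => ?_
      simpa using abs_sub (x j) (x j - x0 j)
    linarith
end

section
/- Let A be a real m×n matrix, r a positive integer, I ⊆ {1,…,n} a fixed index set, and N any norm on ℝ^r. If every matrix X0 ∈ ℝ^{n×r} with row support contained in I is the unique minimizer of ∑_{j=1}^n N(X_{row j}) over {X : AX = AX0}, then every nonzero z in the kernel of A satisfies ∑_{j∈I} |z_j| < ∑_{j∉I} |z_j|; consequently, every x0 ∈ ℝ^n with support(x0) ⊆ I is the unique minimizer of ‖x‖₁ over {x : Ax = Ax0}. -/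
open Matrix Finset

/-- A vector on which an absolutely homogeneous subadditive function does not vanish has
positive value. -/
lemma pos_of_subadditive_of_abs_homogeneous {E : Type*} [AddCommGroup E] [Module ℝ E]
    {N : E → ℝ} (hNsmul : ∀ (a : ℝ) (v), N (a • v) = |a| * N v)
    (hNadd : ∀ v w, N (v + w) ≤ N v + N w) {v : E} (hv : N v ≠ 0) : 0 < N v := by
  have hzero : N 0 = 0 := by simpa using hNsmul 0 v
  have hneg : N (-v) = N v := by simpa using hNsmul (-1) v
  have hadd := hNadd v (-v)
  rw [add_neg_cancel, hzero, hneg] at hadd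
  exact lt_of_le_of_ne (by linarith) hv.symm

/-- Uniform `ℓ₁` recovery on `I` implies the `ℓ₁` null-space property on `I`. -/
lemma l1_null_space_property_of_uniform_recovery {ι κ : Type*} [Fintype ι] [DecidableEq ι]
    (A : Matrix κ ι ℝ) (I : Finset ι)
    (hrec : ∀ x0 : ι → ℝ, (∀ j, j ∉ I → x0 j = 0) →
      ∀ x : ι → ℝ, A.mulVec x = A.mulVec x0 → x ≠ x0 → ∑ j, |x0 j| < ∑ j, |x j|)
    (z : ι → ℝ) (hz : A.mulVec z = 0) (hz0 : z ≠ 0) :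
    ∑ j ∈ I, |z j| < ∑ j ∈ Iᶜ, |z j| := by
  let y : ι → ℝ := fun j => if j ∈ I then z j else 0
  have h := hrec y (fun j hj => if_neg hj) (y - z)
    (by rw [Matrix.mulVec_sub, hz, sub_zero]) (by simpa using hz0)
  have hy : ∑ j, |y j| = ∑ j ∈ I, |z j| := by
    rw [← Finset.sum_subset (Finset.subset_univ I) fun j _ hj => by simp [y, hj]]
    exact Finset.sum_congr rfl fun j hj => by simp [y, hj]
  have hyz : ∑ j, |(y - z) j| = ∑ j ∈ Iᶜ, |z j| := by
    rw [← Finset.sum_subset (Finset.subset_univ Iᶜ) fun j _ hj => by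
      simp [y, Finset.notMem_compl.mp hj]]
    exact Finset.sum_congr rfl fun j hj => by simp [y, Finset.mem_compl.mp hj]
  rwa [hy, hyz] at h

/-- Uniform recovery on a support `I` by sum-of-norms minimization implies the
`ℓ₁` null-space property on `I`, and hence uniform recovery on `I` by `ℓ₁`
(basis pursuit) minimization (Theorem `SumNormsImplication`). -/
theorem sum_of_norms_uniform_recovery_implies_l1
    (m n r : ℕ) (hr : 0 < r) (A : Matrix (Fin m) (Fin n) ℝ)
    (I : Finset (Fin n)) (N : (Fin r → ℝ) → ℝ)
    (hN0 : ∀ v, N v = 0 ↔ v = 0)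
    (hNsmul : ∀ (a : ℝ) (v), N (a • v) = |a| * N v)
    (hNadd : ∀ v w, N (v + w) ≤ N v + N w)
    (hrec : ∀ X0 : Matrix (Fin n) (Fin r) ℝ, (∀ j, j ∉ I → X0 j = 0) →
      ∀ X : Matrix (Fin n) (Fin r) ℝ, A * X = A * X0 → X ≠ X0 →
        ∑ j, N (X0 j) < ∑ j, N (X j)) :
    (∀ z : Fin n → ℝ, A.mulVec z = 0 → z ≠ 0 →
      ∑ j ∈ I, |z j| < ∑ j ∈ Iᶜ, |z j|) ∧
    (∀ x0 : Fin n → ℝ, (∀ j, j ∉ I → x0 j = 0) →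
      ∀ x : Fin n → ℝ, A.mulVec x = A.mulVec x0 → x ≠ x0 →
        ∑ j, |x0 j| < ∑ j, |x j|) := by
  let e : Fin r → ℝ := fun _ => 1
  have he : 0 < N e := pos_of_subadditive_of_abs_homogeneous hNsmul hNadd
    fun h => one_ne_zero (congrFun ((hN0 e).mp h) ⟨0, hr⟩)
  have hrow (x : Fin n → ℝ) : ∑ j, N (vecMulVec x e j) = (∑ j, |x j|) * N e := by
    rw [Finset.sum_mul]
    exact Finset.sum_congr rfl fun j _ => hNsmul (x j) e
  have hl1 : ∀ x0 : Fin n → ℝ, (∀ j, j ∉ I → x0 j = 0) →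
      ∀ x : Fin n → ℝ, A.mulVec x = A.mulVec x0 → x ≠ x0 →
        ∑ j, |x0 j| < ∑ j, |x j| := by
    intro x0 hx0 x hx hne
    have h := hrec (vecMulVec x0 e)
      (fun j hj => by ext k; simp [vecMulVec_apply, hx0 j hj]) (vecMulVec x e)
      (by rw [mul_vecMulVec, mul_vecMulVec, hx])
      (fun h => hne (funext fun j => by
        simpa [vecMulVec_apply, e] using congrFun (congrFun h j) ⟨0, hr⟩))
    rw [hrow, hrow] at h
    exact lt_of_mul_lt_mul_right h he.le
  exact ⟨l1_null_space_property_of_uniform_recovery A I hl1, hl1⟩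
end

section
/- Let A be a real m×n matrix and X0 ∈ ℝ^{n×r}. Then X0 is the unique minimizer of the ℓ_{1,1} norm ‖X‖_{1,1} = ∑_{j=1}^n ∑_{k=1}^r |X_{jk}| over {X ∈ ℝ^{n×r} : AX = AX0} if and only if, for every k ∈ {1,…,r}, the k-th column of X0 is the unique minimizer of ‖x‖₁ over {x ∈ ℝ^n : Ax = A·(X0 column k)}. -/
open Matrix Finset

/-- Recovery by `ℓ_{1,1}` minimization is equivalent to independent `ℓ₁`
(basis pursuit) recovery of each column. -/
theorem l11_recovery_iff_columnwise_l1
    (m n r : ℕ) (A : Matrix (Fin m) (Fin n) ℝ) (X0 : Matrix (Fin n) (Fin r) ℝ) :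
    (∀ X : Matrix (Fin n) (Fin r) ℝ, A * X = A * X0 → X ≠ X0 →
      ∑ j, ∑ k, |X0 j k| < ∑ j, ∑ k, |X j k|) ↔
    (∀ k : Fin r, ∀ x : Fin n → ℝ,
      A.mulVec x = A.mulVec (fun j => X0 j k) → x ≠ (fun j => X0 j k) →
        ∑ j, |X0 j k| < ∑ j, |x j|) := by
  have hcol (Y : Matrix (Fin n) (Fin r) ℝ) (i : Fin m) (k : Fin r) :
      (A * Y) i k = A.mulVec (fun j => Y j k) i := rfl
  constructor
  · intro h k x hx hne
    have hself (j : Fin n) : X0.updateCol k x j k = x j := by simp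
    have hother {l : Fin r} (hl : l ≠ k) (j : Fin n) : X0.updateCol k x j l = X0 j l := by
      simp [hl]
    have hlt := h (X0.updateCol k x) ?_ ?_
    · rw [sum_comm, sum_comm (f := fun j l => |X0.updateCol k x j l|),
        ← add_sum_erase _ _ (mem_univ k),
        ← add_sum_erase _ (fun l => ∑ j, |X0.updateCol k x j l|) (mem_univ k)] at hlt
      have hrest : ∑ l ∈ univ.erase k, ∑ j, |X0.updateCol k x j l| =
          ∑ l ∈ univ.erase k, ∑ j, |X0 j l| :=
        sum_congr rfl fun l hl => by simp only [hother (ne_of_mem_erase hl)]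
      simp only [hrest, hself] at hlt
      exact lt_of_add_lt_add_right hlt
    · ext i l
      rw [hcol, hcol]
      obtain rfl | hl := eq_or_ne l k
      · simp only [hself]
        exact congrFun hx i
      · simp only [hother hl]
    · intro heq
      exact hne (funext fun j => by rw [← hself j, heq])
  · intro h X hX hne
    have hfeas (k : Fin r) : A.mulVec (fun j => X j k) = A.mulVec (fun j => X0 j k) := by
      ext i
      rw [← hcol, ← hcol, hX]
    obtain ⟨k, hk⟩ : ∃ k, (fun j => X j k) ≠ fun j => X0 j k := by
      by_contra! hall
      exact hne (Matrix.ext fun j k => congrFun (hall k) j)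
    rw [sum_comm, sum_comm (f := fun j l => |X j l|)]
    refine sum_lt_sum (fun l _ => ?_) ⟨k, mem_univ k, h k _ (hfeas k) hk⟩
    by_cases hl : (fun j => X j l) = fun j => X0 j l
    · exact (sum_congr rfl fun j _ => congrArg abs (congrFun hl j).symm).le
    · exact (h l _ (hfeas l) hl).le
end

section
/- Let A be a real m×n matrix, b ∈ ℝ^m, and let x̄ ∈ ℝ^n satisfy Ax̄ = b. Then x̄ is a minimizer of ‖x‖₁ over {x ∈ ℝ^n : Ax = b} if and only if there exists y ∈ ℝ^m such that |(Aᵀy)_j| ≤ 1 for all j ∉ support(x̄) and (Aᵀy)_j = sign(x̄_j) for all j ∈ support(x̄). -/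
open Matrix Finset

/-- The one-sided derivative of `|·|` at `a` in direction `d`. -/
noncomputable def absDirDeriv (a d : ℝ) : ℝ :=
  if a = 0 then |d| else Real.sign a * d

lemma absDirDeriv_mul (a d : ℝ) {c : ℝ} (hc : 0 < c) :
    absDirDeriv a (c * d) = c * absDirDeriv a d := by
  unfold absDirDeriv
  split_ifs
  · rw [abs_mul, abs_of_pos hc]
  · ring

lemma absDirDeriv_add_le (a d e : ℝ) :
    absDirDeriv a (d + e) ≤ absDirDeriv a d + absDirDeriv a e := by
  unfold absDirDeriv
  split_ifs
  · exact abs_add_le d e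
  · exact (mul_add _ _ _).le

lemma absDirDeriv_zero (a : ℝ) : absDirDeriv a 0 = 0 := by
  simp [absDirDeriv]

lemma abs_add_mul_eventually (a d : ℝ) :
    ∀ᶠ t in nhdsWithin (0 : ℝ) (Set.Ioi 0), |a + t * d| = |a| + t * absDirDeriv a d := by
  have hlim : Filter.Tendsto (fun t : ℝ => a + t * d) (nhdsWithin 0 (Set.Ioi 0)) (nhds a) := by
    have hcont : Continuous fun t : ℝ => a + t * d := by fun_prop
    simpa using (hcont.tendsto 0).mono_left nhdsWithin_le_nhds
  rcases lt_trichotomy a 0 with ha | rfl | ha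
  · filter_upwards [hlim.eventually_lt_const ha] with t ht
    rw [abs_of_neg ht, abs_of_neg ha, absDirDeriv, if_neg ha.ne, Real.sign_of_neg ha]
    ring
  · filter_upwards [self_mem_nhdsWithin] with t ht
    simp [absDirDeriv, abs_mul, abs_of_pos (Set.mem_Ioi.mp ht)]
  · filter_upwards [hlim.eventually_const_lt ha] with t ht
    rw [abs_of_pos ht, abs_of_pos ha, absDirDeriv, if_neg ha.ne', Real.sign_of_pos ha]
    ring

/-- The one-sided derivative of the `ℓ₁` norm is nonnegative along every ray on which the base
point is a minimizer. -/
lemma sum_absDirDeriv_nonneg {ι : Type*} [Fintype ι] (x d : ι → ℝ)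
    (hmin : ∀ t : ℝ, ∑ j, |x j| ≤ ∑ j, |x j + t * d j|) :
    0 ≤ ∑ j, absDirDeriv (x j) (d j) := by
  obtain ⟨t, ht, htpos⟩ := ((Filter.eventually_all.2 fun j =>
    abs_add_mul_eventually (x j) (d j)).and self_mem_nhdsWithin).exists
  have h := hmin t
  simp only [ht, sum_add_distrib, ← mul_sum] at h
  exact nonneg_of_mul_nonneg_right (by linarith) (Set.mem_Ioi.mp htpos)

/-- A sublinear function that is nonnegative on the kernel of a matrix `A` dominates a linear
functional of the form `x ↦ ⟨y, A x⟩`. -/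
lemma exists_dotProduct_mulVec_le_of_nonneg_on_ker {ι κ : Type*} [Fintype ι] [Fintype κ]
    (A : Matrix κ ι ℝ) (N : (ι → ℝ) → ℝ)
    (N_hom : ∀ c : ℝ, 0 < c → ∀ x, N (c • x) = c * N x)
    (N_add : ∀ x y, N (x + y) ≤ N x + N y)
    (hN : ∀ x, A *ᵥ x = 0 → 0 ≤ N x) :
    ∃ y : κ → ℝ, ∀ x, y ⬝ᵥ A *ᵥ x ≤ N x := by
  classical
  obtain ⟨g, hg, hgN⟩ := exists_extension_of_le_sublinear
    ⟨LinearMap.ker A.mulVecLin, 0⟩ N N_hom N_add (fun x => hN x x.2)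
  have hmem : g ∈ LinearMap.range A.mulVecLin.dualMap := by
    rw [LinearMap.range_dualMap_eq_dualAnnihilator_ker, Submodule.mem_dualAnnihilator]
    exact fun x hx => hg ⟨x, hx⟩
  obtain ⟨φ, rfl⟩ := hmem
  obtain ⟨y, rfl⟩ := (dotProductEquiv ℝ κ).surjective φ
  exact ⟨y, hgN⟩

/-- KKT/subgradient optimality characterization for basis pursuit: a feasible
point `xb` minimizes the `ℓ₁` norm over `{x : Ax = b}` iff there is a dual
vector `y` with `|(Aᵀy)_j| ≤ 1` off the support of `xb` and
`(Aᵀy)_j = sign (xb j)` on the support. -/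
theorem basis_pursuit_optimality_iff_dual_certificate
    (m n : ℕ) (A : Matrix (Fin m) (Fin n) ℝ) (b : Fin m → ℝ)
    (xb : Fin n → ℝ) (hfeas : A.mulVec xb = b) :
    (∀ x : Fin n → ℝ, A.mulVec x = b → ∑ j, |xb j| ≤ ∑ j, |x j|) ↔
    (∃ y : Fin m → ℝ,
      (∀ j, xb j = 0 → |Aᵀ.mulVec y j| ≤ 1) ∧
      (∀ j, xb j ≠ 0 → Aᵀ.mulVec y j = Real.sign (xb j))) := by
  constructor
  · intro hmin
    obtain ⟨y, hy⟩ := exists_dotProduct_mulVec_le_of_nonneg_on_ker A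
      (fun d => ∑ j, absDirDeriv (xb j) (d j))
      (fun c hc d => by simp [absDirDeriv_mul _ _ hc, mul_sum])
      (fun d e => by
        rw [← sum_add_distrib]
        exact sum_le_sum fun j _ => absDirDeriv_add_le _ _ _)
      (fun d hd => sum_absDirDeriv_nonneg xb d fun t =>
        hmin (xb + t • d) (by rw [mulVec_add, mulVec_smul, hd, smul_zero, add_zero, hfeas]))
    have hcoord (j : Fin n) (s : ℝ) : (Aᵀ *ᵥ y) j * s ≤ absDirDeriv (xb j) s := by
      have h := hy (Pi.single j s)
      rw [dotProduct_mulVec, ← mulVec_transpose, dotProduct_single,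
        sum_eq_single j (fun i _ hij => by rw [Pi.single_eq_of_ne hij, absDirDeriv_zero])
          (by simp), Pi.single_eq_same] at h
      exact h
    refine ⟨y, fun j hj => ?_, fun j hj => ?_⟩
    · have h₁ := hcoord j 1
      have h₂ := hcoord j (-1)
      simp only [absDirDeriv, if_pos hj, abs_neg, abs_one] at h₁ h₂
      exact abs_le.2 ⟨by linarith, by linarith⟩
    · have h₁ := hcoord j 1
      have h₂ := hcoord j (-1)
      simp only [absDirDeriv, if_neg hj] at h₁ h₂
      linarith
  · rintro ⟨y, hoff, hon⟩ x hx
    have hbound (j : Fin n) : |(Aᵀ *ᵥ y) j| ≤ 1 := by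
      by_cases hj : xb j = 0
      · exact hoff j hj
      · rw [hon j hj]
        rcases Real.sign_apply_eq_of_ne_zero _ hj with h | h <;> simp [h]
    calc ∑ j, |xb j| = Aᵀ *ᵥ y ⬝ᵥ xb := by
          refine sum_congr rfl fun j _ => ?_
          by_cases hj : xb j = 0
          · simp [hj]
          · rw [hon j hj]
            rcases lt_or_gt_of_ne hj with h | h
            · rw [Real.sign_of_neg h, abs_of_neg h, neg_one_mul]
            · rw [Real.sign_of_pos h, abs_of_pos h, one_mul]
      _ = Aᵀ *ᵥ y ⬝ᵥ x := by
          rw [mulVec_transpose, ← dotProduct_mulVec, ← dotProduct_mulVec, hfeas, hx]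
      _ ≤ ∑ j, |x j| := sum_le_sum fun j _ => by
          calc (Aᵀ *ᵥ y) j * x j ≤ |(Aᵀ *ᵥ y) j| * |x j| :=
                (le_abs_self _).trans (abs_mul _ _).le
            _ ≤ |x j| := mul_le_of_le_one_left (abs_nonneg _) (hbound j)
end

section
/- Let A be a real m×n matrix, b ∈ ℝ^m, and let x̄ ∈ ℝ^n satisfy Ax̄ = b. Suppose there exists y ∈ ℝ^m such that (Aᵀy)_j = sign(x̄_j) for all j ∈ support(x̄) and |(Aᵀy)_j| < 1 for all j ∉ support(x̄), and suppose the columns {a_j : j ∈ support(x̄)} of A are linearly independent. Then x̄ is the unique minimizer of ‖x‖₁ over {x ∈ ℝ^n : Ax = b}. -/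
open Matrix Finset

/-- A vector in the kernel of `A` vanishes if the columns of `A` on a set containing its support
are linearly independent. -/
theorem eq_zero_of_mulVec_eq_zero_of_linearIndependent_columns {ι κ R : Type*} [Fintype κ]
    [CommRing R] {A : Matrix ι κ R} {p : κ → Prop}
    (hind : LinearIndependent R (fun j : {j : κ // p j} => Aᵀ j.1))
    {h : κ → R} (hker : A *ᵥ h = 0) (hsupp : ∀ j, ¬ p j → h j = 0) : h = 0 := by
  classical
  have hsum : ∑ j : {j : κ // p j}, h j.1 • Aᵀ j.1 = 0 := by
    have hsub : ∑ j : {j : κ // ¬ p j}, h j.1 • Aᵀ j.1 = 0 :=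
      Finset.sum_eq_zero fun j _ => by rw [hsupp j.1 j.2, zero_smul]
    have hsplit := Fintype.sum_subtype_add_sum_subtype p (fun j => h j • Aᵀ j)
    rw [hsub, add_zero] at hsplit
    rw [hsplit, ← hker, Matrix.mulVec_eq_sum]
    simp
  funext j
  by_cases hj : p j
  · exact Fintype.linearIndependent_iff.mp hind (fun j => h j.1) hsum ⟨j, hj⟩
  · exact hsupp j hj

theorem Real.sign_mul_self_eq_abs (r : ℝ) : Real.sign r * r = |r| := by
  rcases lt_trichotomy r 0 with hr | rfl | hr
  · rw [Real.sign_of_neg hr, abs_of_neg hr, neg_one_mul]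
  · simp
  · rw [Real.sign_of_pos hr, abs_of_pos hr, one_mul]

/-- Fuchs' sufficient condition: if a feasible `xb` admits a dual vector `y`
with `(Aᵀy)_j = sign (xb j)` on its support and `|(Aᵀy)_j| < 1` off its
support, and the columns of `A` indexed by the support are linearly
independent, then `xb` is the unique `ℓ₁` minimizer over `{x : Ax = b}`. -/
theorem fuchs_sufficient_condition_unique_l1_minimizer
    (m n : ℕ) (A : Matrix (Fin m) (Fin n) ℝ) (b : Fin m → ℝ)
    (xb : Fin n → ℝ) (hfeas : A.mulVec xb = b) (y : Fin m → ℝ)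
    (hon : ∀ j, xb j ≠ 0 → Aᵀ.mulVec y j = Real.sign (xb j))
    (hoff : ∀ j, xb j = 0 → |Aᵀ.mulVec y j| < 1)
    (hind : LinearIndependent ℝ (fun j : {j : Fin n // xb j ≠ 0} => Aᵀ j.1)) :
    ∀ x : Fin n → ℝ, A.mulVec x = b → x ≠ xb →
      ∑ j, |xb j| < ∑ j, |x j| := by
  intro x hx hne
  have hdual (v : Fin n → ℝ) (hv : A *ᵥ v = b) : ∑ j, (Aᵀ *ᵥ y) j * v j = y ⬝ᵥ b := by
    rw [← hv, Matrix.dotProduct_mulVec, ← Matrix.mulVec_transpose]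
    rfl
  have habs : ∑ j, |xb j| = ∑ j, (Aᵀ *ᵥ y) j * x j := by
    rw [hdual x hx, ← hdual xb hfeas]
    refine Finset.sum_congr rfl fun j _ => ?_
    by_cases hj : xb j = 0
    · simp [hj]
    · rw [hon j hj, Real.sign_mul_self_eq_abs]
  have hbound (j : Fin n) : |(Aᵀ *ᵥ y) j| ≤ 1 := by
    by_cases hj : xb j = 0
    · exact (hoff j hj).le
    · rw [hon j hj]
      rcases Real.sign_apply_eq_of_ne_zero _ hj with h | h <;> simp [h]
  obtain ⟨k, hk, hxk⟩ : ∃ k, xb k = 0 ∧ x k ≠ 0 := by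
    by_contra! hcon
    refine hne (sub_eq_zero.mp
      (eq_zero_of_mulVec_eq_zero_of_linearIndependent_columns hind ?_ fun j hj => ?_))
    · rw [Matrix.mulVec_sub, hx, hfeas, sub_self]
    · have hj := not_not.mp hj
      simp [hj, hcon j hj]
  rw [habs]
  refine Finset.sum_lt_sum (fun j _ => ?_) ⟨k, Finset.mem_univ k, ?_⟩
  · refine (le_abs_self _).trans ?_
    rw [abs_mul]
    exact mul_le_of_le_one_left (abs_nonneg _) (hbound j)
  · refine (le_abs_self _).trans_lt ?_
    rw [abs_mul]
    exact mul_lt_of_lt_one_left (abs_pos.mpr hxk) (hoff k hk)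
end

section
/- Let A be a real m×n matrix, B a real m×r matrix, and X ∈ ℝ^{n×r} with row support I = {j : X_{row j} ≠ 0}. Suppose there exists Y ∈ ℝ^{m×r} such that: (a) AX = B; (b) for every j ∈ I, the j-th row of AᵀY equals X_{row j}/‖X_{row j}‖₂; (c) for every j ∉ I, the ℓ2 norm of the j-th row of AᵀY is strictly less than 1; and (d) the columns {a_j : j ∈ I} of A are linearly independent. Then X is the unique minimizer of ‖X'‖_{1,2} over {X' ∈ ℝ^{n×r} : AX' = B}. -/
open Matrix Finset

/-- The Euclidean (`ℓ₂`) norm of a vector in `ℝ^r`. -/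
noncomputable def l2norm {r : ℕ} (v : Fin r → ℝ) : ℝ :=
  Real.sqrt (∑ k, v k ^ 2)

theorem l2norm_nonneg {r : ℕ} (v : Fin r → ℝ) : 0 ≤ l2norm v :=
  Real.sqrt_nonneg _

theorem l2norm_sq {r : ℕ} (v : Fin r → ℝ) : l2norm v ^ 2 = v ⬝ᵥ v := by
  rw [l2norm, Real.sq_sqrt (Finset.sum_nonneg fun _ _ => sq_nonneg _)]
  simp [dotProduct, sq]

theorem l2norm_pos {r : ℕ} {v : Fin r → ℝ} (hv : v ≠ 0) : 0 < l2norm v := by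
  refine (l2norm_nonneg v).lt_of_ne' fun h => hv ?_
  rw [← dotProduct_self_eq_zero, ← l2norm_sq, h, zero_pow two_ne_zero]

/-- The Cauchy–Schwarz inequality. -/
theorem dotProduct_le_l2norm_mul {r : ℕ} (v w : Fin r → ℝ) :
    v ⬝ᵥ w ≤ l2norm v * l2norm w :=
  Real.sum_mul_le_sqrt_mul_sqrt _ v w

theorem l2norm_inv_smul_self {r : ℕ} {v : Fin r → ℝ} (hv : v ≠ 0) :
    l2norm ((l2norm v)⁻¹ • v) = 1 := by
  have hpos := l2norm_pos hv
  rw [← sq_eq_sq₀ (l2norm_nonneg _) zero_le_one, l2norm_sq, smul_dotProduct, dotProduct_smul,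
    ← l2norm_sq, smul_eq_mul, smul_eq_mul]
  field_simp

/-- The Frobenius pairing of `Aᵀ * Y` with `X` depends on `X` only through `A * X`. -/
theorem sum_transpose_mul_dotProduct {m n r : ℕ} (A : Matrix (Fin m) (Fin n) ℝ)
    (X : Matrix (Fin n) (Fin r) ℝ) (Y : Matrix (Fin m) (Fin r) ℝ) :
    ∑ j, (Aᵀ * Y) j ⬝ᵥ X j = (Yᵀ * (A * X)).trace := by
  have h : ∑ j, (Aᵀ * Y) j ⬝ᵥ X j = ((Aᵀ * Y) * Xᵀ).trace := by
    simp [Matrix.trace, Matrix.mul_apply, dotProduct]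
  rw [h, ← Matrix.trace_transpose, Matrix.transpose_mul, Matrix.transpose_mul,
    Matrix.transpose_transpose, Matrix.transpose_transpose, Matrix.trace_mul_comm,
    Matrix.mul_assoc]

/-- A matrix supported on rows whose matching columns of `A` are linearly independent vanishes
as soon as its product with `A` does. -/
theorem eq_zero_of_mul_eq_zero_of_linearIndependent {m n r : ℕ} {A : Matrix (Fin m) (Fin n) ℝ}
    {D : Matrix (Fin n) (Fin r) ℝ} {p : Fin n → Prop}
    (hind : LinearIndependent ℝ (fun j : {j : Fin n // p j} => Aᵀ j.1))
    (hD : ∀ j, ¬ p j → D j = 0) (hAD : A * D = 0) : D = 0 := by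
  classical
  ext j k
  by_cases hj : p j
  · refine Fintype.linearIndependent_iff.mp hind (fun i => D i.1 k) ?_ ⟨j, hj⟩
    ext i
    have hik : ∑ l, A i l * D l k = 0 := by
      simpa [Matrix.mul_apply] using congrFun (congrFun hAD i) k
    rw [← Fintype.sum_subtype_add_sum_subtype p,
      Finset.sum_eq_zero (s := (Finset.univ : Finset {l // ¬ p l}))
        (fun l _ => by simp [hD l.1 l.2]), add_zero] at hik
    simpa [Finset.sum_apply, mul_comm] using hik
  · simp [hD j hj]

/-- Sufficient conditions for `X` to be the unique minimizer of the
`ℓ_{1,2}` problem `min ‖X'‖_{1,2} s.t. AX' = B`. -/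
theorem l12_sufficient_conditions_unique_minimizer
    (m n r : ℕ) (A : Matrix (Fin m) (Fin n) ℝ) (B : Matrix (Fin m) (Fin r) ℝ)
    (X : Matrix (Fin n) (Fin r) ℝ) (Y : Matrix (Fin m) (Fin r) ℝ)
    (hfeas : A * X = B)
    (hon : ∀ j, X j ≠ 0 → (Aᵀ * Y) j = (l2norm (X j))⁻¹ • X j)
    (hoff : ∀ j, X j = 0 → l2norm ((Aᵀ * Y) j) < 1)
    (hind : LinearIndependent ℝ (fun j : {j : Fin n // X j ≠ 0} => Aᵀ j.1)) :
    ∀ X' : Matrix (Fin n) (Fin r) ℝ, A * X' = B → X' ≠ X →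
      ∑ j, l2norm (X j) < ∑ j, l2norm (X' j) := by
  intro X' hX' hne
  have hZ : ∀ j, l2norm ((Aᵀ * Y) j) ≤ 1 := fun j => by
    by_cases hj : X j = 0
    · exact (hoff j hj).le
    · rw [hon j hj, l2norm_inv_smul_self hj]
  have hXsum : ∑ j, l2norm (X j) = ∑ j, (Aᵀ * Y) j ⬝ᵥ X' j := by
    rw [sum_transpose_mul_dotProduct, hX', ← hfeas, ← sum_transpose_mul_dotProduct]
    refine Finset.sum_congr rfl fun j _ => ?_
    by_cases hj : X j = 0
    · simp [hj, l2norm]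
    · have hpos := l2norm_pos hj
      rw [hon j hj, smul_dotProduct, ← l2norm_sq, smul_eq_mul]
      field_simp
  obtain ⟨j, hj, hj'⟩ : ∃ j, X j = 0 ∧ X' j ≠ 0 := by
    by_contra! h
    refine hne (sub_eq_zero.mp (eq_zero_of_mul_eq_zero_of_linearIndependent hind
      (fun j hj => ?_) (by rw [Matrix.mul_sub, hX', hfeas, sub_self])))
    have hXj := not_not.mp hj
    ext k
    simp [hXj, h j hXj]
  rw [hXsum]
  refine Finset.sum_lt_sum (fun i _ => ?_) ⟨j, Finset.mem_univ j, ?_⟩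
  · exact (dotProduct_le_l2norm_mul _ _).trans
      (mul_le_of_le_one_left (l2norm_nonneg _) (hZ i))
  · exact (dotProduct_le_l2norm_mul _ _).trans_lt
      (mul_lt_of_lt_one_left (l2norm_pos hj') (hoff j hj))
end

section
/- Let A be a real m×n matrix and let x0, x1 ∈ ℝ^n have the same support and the same signs, i.e., sign(x1_j) = sign(x0_j) for every j (in particular x1_j = 0 exactly when x0_j = 0). If x0 is the unique minimizer of ‖x‖₁ over {x : Ax = Ax0}, then x1 is the unique minimizer of ‖x‖₁ over {x : Ax = Ax1}. That is, recovery by basis pursuit depends only on the support and sign pattern of the vector to be recovered. -/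
open Matrix Finset

/-- If `a` and `b` have the same sign, then for small `t > 0` the increment of `|·|` at `a` in
direction `t * h` is at most `t` times its increment at `b` in direction `h`. -/
lemma eventually_abs_add_mul_sub_abs_le {a b : ℝ} (hab : Real.sign b = Real.sign a) (h : ℝ) :
    ∀ᶠ t in nhdsWithin (0 : ℝ) (Set.Ioi 0), |a + t * h| - |a| ≤ t * (|b + h| - |b|) := by
  have hlim : Filter.Tendsto (fun t : ℝ => a + t * h) (nhdsWithin 0 (Set.Ioi 0)) (nhds a) := by
    have hcont : Continuous fun t : ℝ => a + t * h := by fun_prop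
    simpa using (hcont.tendsto 0).mono_left nhdsWithin_le_nhds
  rcases lt_trichotomy a 0 with ha | rfl | ha
  · have hb : b < 0 := by
      rw [Real.sign_of_neg ha] at hab
      rcases lt_trichotomy b 0 with hb | rfl | hb
      · exact hb
      · norm_num at hab
      · norm_num [Real.sign_of_pos hb] at hab
    filter_upwards [hlim.eventually_lt_const ha, self_mem_nhdsWithin] with t hat ht
    rw [abs_of_neg hat, abs_of_neg ha, abs_of_neg hb]
    have := mul_le_mul_of_nonneg_left (neg_le_abs (b + h)) (le_of_lt (Set.mem_Ioi.mp ht))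
    linarith
  · have hb : b = 0 := by simpa [Real.sign_eq_zero_iff] using hab
    filter_upwards [self_mem_nhdsWithin] with t ht
    simp [hb, abs_mul, abs_of_pos (Set.mem_Ioi.mp ht)]
  · have hb : 0 < b := by
      rw [Real.sign_of_pos ha] at hab
      rcases lt_trichotomy b 0 with hb | rfl | hb
      · norm_num [Real.sign_of_neg hb] at hab
      · norm_num at hab
      · exact hb
    filter_upwards [hlim.eventually_const_lt ha, self_mem_nhdsWithin] with t hat ht
    rw [abs_of_pos hat, abs_of_pos ha, abs_of_pos hb]
    have := mul_le_mul_of_nonneg_left (le_abs_self (b + h)) (le_of_lt (Set.mem_Ioi.mp ht))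
    linarith

/-- Recovery by basis pursuit depends only on the support and sign pattern:
if `x0` and `x1` have the same signs entrywise (in particular the same
support) and `x0` is uniquely recovered, then so is `x1`. -/
theorem l1_recovery_depends_only_on_sign_pattern
    (m n : ℕ) (A : Matrix (Fin m) (Fin n) ℝ) (x0 x1 : Fin n → ℝ)
    (hsign : ∀ j, Real.sign (x1 j) = Real.sign (x0 j))
    (h0 : ∀ x : Fin n → ℝ, A.mulVec x = A.mulVec x0 → x ≠ x0 →
      ∑ j, |x0 j| < ∑ j, |x j|) :
    ∀ x : Fin n → ℝ, A.mulVec x = A.mulVec x1 → x ≠ x1 →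
      ∑ j, |x1 j| < ∑ j, |x j| := by
  intro x hx hne
  obtain ⟨t, hle, ht⟩ := ((Filter.eventually_all.2 fun j =>
    eventually_abs_add_mul_sub_abs_le (hsign j) ((x - x1) j)).and self_mem_nhdsWithin).exists
  have ht : 0 < t := ht
  have hlt := h0 (x0 + t • (x - x1))
    (by rw [mulVec_add, mulVec_smul, mulVec_sub, hx, sub_self, smul_zero, add_zero])
    (by simpa [ht.ne', sub_eq_zero] using hne)
  have hsum := Finset.sum_le_sum fun j (_ : j ∈ Finset.univ) => hle j
  simp only [← Finset.mul_sum, Finset.sum_sub_distrib, Pi.sub_apply, add_sub_cancel] at hsum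
  simp only [Pi.add_apply, Pi.smul_apply, Pi.sub_apply, smul_eq_mul] at hlt
  exact sub_pos.1 (pos_of_mul_pos_right ((sub_pos.2 hlt).trans_le hsum) ht.le)
end

section
/- Let A be a real m×n matrix such that every 1-sparse vector is uniquely recovered by basis pursuit, i.e., for every j and every t ≠ 0 the vector t·e_j is the unique minimizer of ‖x‖₁ over {x : Ax = t·A_{col j}}. Let x ∈ ℝ^n have at least m+1 nonzero entries and let X0 = diag(x) ∈ ℝ^{n×n}. Then: (i) X0 is the unique minimizer of ‖X‖_{1,1} over {X ∈ ℝ^{n×n} : AX = A·X0}; but (ii) X0 is not a minimizer of ‖X‖_{1,2} over {X ∈ ℝ^{n×n} : AX = A·X0}. -/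
open Matrix Finset

/-- A matrix with fewer rows than the size of a set `S` of columns has a nonzero kernel vector
supported on `S`. -/
theorem exists_mulVec_eq_zero_supported {m n : ℕ} (A : Matrix (Fin m) (Fin n) ℝ)
    (S : Finset (Fin n)) (hS : m < S.card) :
    ∃ v : Fin n → ℝ, v ≠ 0 ∧ (∀ j, j ∉ S → v j = 0) ∧ A.mulVec v = 0 := by
  let E : (S → ℝ) →ₗ[ℝ] (Fin n → ℝ) :=
    Function.ExtendByZero.linearMap ℝ (Subtype.val : S → Fin n)
  have hE (u : S → ℝ) (j : S) : E u j = u j :=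
    Subtype.val_injective.extend_apply u (0 : Fin n → ℝ) j
  have hker : LinearMap.ker (A.mulVecLin ∘ₗ E) ≠ ⊥ := by
    apply LinearMap.ker_ne_bot_of_finrank_lt
    simpa using hS
  obtain ⟨u, hu, hu0⟩ := Submodule.exists_mem_ne_zero_of_ne_bot hker
  refine ⟨E u, fun h => hu0 ?_, fun j hj => ?_, by simpa using hu⟩
  · funext j
    rw [← hE u j, h]
    rfl
  · exact Function.extend_apply' u (0 : Fin n → ℝ) j fun ⟨k, hk⟩ => hj (hk ▸ k.2)

theorem l2norm_diagonal_row {n : ℕ} (x : Fin n → ℝ) (j : Fin n) :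
    l2norm (Matrix.diagonal x j) = |x j| := by
  have h : ∑ k, Matrix.diagonal x j k ^ 2 = x j ^ 2 := by
    rw [Finset.sum_eq_single j] <;> simp +contextual [eq_comm]
  rw [l2norm, h, Real.sqrt_sq_eq_abs]

/-- First-order upper bound for the Euclidean norm of a perturbation of a multiple of a basis
vector. -/
theorem l2norm_diagonal_row_add_le {n : ℕ} (x w : Fin n → ℝ) (j : Fin n) (hj : x j ≠ 0) (c : ℝ) :
    l2norm (fun k => Matrix.diagonal x j k + c * w k) ≤
      |x j| + (2 * c * x j * w j + c ^ 2 * ∑ k, w k ^ 2) / (2 * |x j|) := by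
  have hpos : 0 < |x j| := abs_pos.mpr hj
  have hsum : ∑ k, (Matrix.diagonal x j k + c * w k) ^ 2 =
      |x j| ^ 2 + (2 * c * x j * w j + c ^ 2 * ∑ k, w k ^ 2) := by
    have hexp (k : Fin n) : (Matrix.diagonal x j k + c * w k) ^ 2 =
        (if j = k then x j ^ 2 + 2 * c * x j * w j else 0) + c ^ 2 * w k ^ 2 := by
      rw [Matrix.diagonal_apply]
      split_ifs with h
      · subst h; ring
      · ring
    simp only [hexp, Finset.sum_add_distrib, Finset.sum_ite_eq, Finset.mem_univ, if_true,
      ← Finset.mul_sum, sq_abs]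
    ring
  have hnonneg : 0 ≤ ∑ k, (Matrix.diagonal x j k + c * w k) ^ 2 :=
    Finset.sum_nonneg fun k _ => sq_nonneg _
  rw [l2norm, hsum]
  rw [hsum] at hnonneg
  set b := 2 * c * x j * w j + c ^ 2 * ∑ k, w k ^ 2
  set a := |x j|
  have hab : a + b / (2 * a) = (a ^ 2 + (a ^ 2 + b)) / (2 * a) := by
    field_simp
    ring
  apply Real.sqrt_le_iff.mpr
  refine ⟨by rw [hab]; positivity, ?_⟩
  have hsq : (a + b / (2 * a)) ^ 2 = a ^ 2 + b + (b / (2 * a)) ^ 2 := by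
    field_simp
    ring
  rw [hsq]
  linarith [sq_nonneg (b / (2 * a))]

/-- If `A` has a nonzero kernel vector supported on the support of `x`, then some `X` with
`A * X = A * diagonal x` has smaller `ℓ_{1,2}` norm than `diagonal x`. -/
theorem exists_sum_l2norm_lt_of_mulVec_eq_zero {m n : ℕ} (A : Matrix (Fin m) (Fin n) ℝ)
    (x v : Fin n → ℝ) (hv : v ≠ 0) (hsupp : ∀ j, x j = 0 → v j = 0) (hAv : A.mulVec v = 0) :
    ∃ X : Matrix (Fin n) (Fin n) ℝ, A * X = A * Matrix.diagonal x ∧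
      ∑ j, l2norm (X j) < ∑ j, l2norm (Matrix.diagonal x j) := by
  set w : Fin n → ℝ := fun j => -(SignType.sign (x j) * v j) with hw
  set W : ℝ := ∑ k, v k ^ 2 with hW
  set C : ℝ := ∑ k, v k ^ 2 / (2 * |x k|) with hC
  have hWpos : 0 < W := by
    obtain ⟨j, hj⟩ := Function.ne_iff.mp hv
    exact Finset.sum_pos' (fun k _ => sq_nonneg _) ⟨j, Finset.mem_univ j, by
      have : v j ≠ 0 := hj
      positivity⟩
  have hCnonneg : 0 ≤ C := Finset.sum_nonneg fun k _ => by positivity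
  have hwW : ∑ k, w k ^ 2 = W := by
    refine Finset.sum_congr rfl fun k _ => ?_
    by_cases hk : x k = 0
    · simp [hw, hk, hsupp k hk]
    · rcases lt_or_gt_of_ne hk with h | h <;> simp [hw, h]
  set t : ℝ := 1 / (C + 1) with ht
  have htpos : 0 < t := by positivity
  have htC : t * C < 1 := by
    rw [ht, one_div_mul_eq_div, div_lt_one (by positivity)]
    linarith
  refine ⟨Matrix.diagonal x + Matrix.vecMulVec (t • v) w, ?_, ?_⟩
  · rw [Matrix.mul_add, Matrix.mul_vecMulVec, Matrix.mulVec_smul, hAv]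
    simp
  · have hrow (j : Fin n) : l2norm ((Matrix.diagonal x + Matrix.vecMulVec (t • v) w) j) ≤
        |x j| - t * v j ^ 2 + t ^ 2 * W * (v j ^ 2 / (2 * |x j|)) := by
      have hrw : (Matrix.diagonal x + Matrix.vecMulVec (t • v) w) j =
          fun k => Matrix.diagonal x j k + (t * v j) * w k := by
        funext k
        simp [Matrix.vecMulVec_apply, mul_assoc]
      rw [hrw]
      by_cases hj : x j = 0
      · have h0 : l2norm (fun k => Matrix.diagonal x j k) = |x j| := l2norm_diagonal_row x j
        simp [hsupp j hj, h0]
      · refine (l2norm_diagonal_row_add_le x w j hj (t * v j)).trans (le_of_eq ?_)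
        have hxw : x j * w j = -(|x j| * v j) := by
          rw [← self_mul_sign (x j)]
          simp only [hw]
          ring
        have habs : |x j| ≠ 0 := abs_ne_zero.mpr hj
        rw [hwW, mul_assoc _ (x j), hxw]
        field_simp
        ring
    calc ∑ j, l2norm ((Matrix.diagonal x + Matrix.vecMulVec (t • v) w) j)
        ≤ ∑ j, (|x j| - t * v j ^ 2 + t ^ 2 * W * (v j ^ 2 / (2 * |x j|))) :=
          Finset.sum_le_sum fun j _ => hrow j
      _ = ∑ j, |x j| - t * W * (1 - t * C) := by
          rw [Finset.sum_add_distrib, Finset.sum_sub_distrib, ← Finset.mul_sum, ← Finset.mul_sum,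
            ← hW, ← hC]
          ring
      _ < ∑ j, |x j| := sub_lt_self _ (mul_pos (mul_pos htpos hWpos) (sub_pos.mpr htC))
      _ = ∑ j, l2norm (Matrix.diagonal x j) := by simp only [l2norm_diagonal_row]

/-- If every column of `X₀` is the strict `ℓ₁` minimizer of its own basis pursuit problem, then
`X₀` is the strict `ℓ_{1,1}` minimizer. -/
theorem sum_abs_lt_of_forall_col {m n r : ℕ} (A : Matrix (Fin m) (Fin n) ℝ)
    (X₀ : Matrix (Fin n) (Fin r) ℝ)
    (hcol : ∀ k, ∀ y : Fin n → ℝ, A.mulVec y = A.mulVec (X₀.col k) → y ≠ X₀.col k →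
      ∑ i, |X₀.col k i| < ∑ i, |y i|)
    (X : Matrix (Fin n) (Fin r) ℝ) (hX : A * X = A * X₀) (hne : X ≠ X₀) :
    ∑ j, ∑ k, |X₀ j k| < ∑ j, ∑ k, |X j k| := by
  have hfeas (k : Fin r) : A.mulVec (X.col k) = A.mulVec (X₀.col k) := by
    funext i
    exact congrFun (congrFun hX i) k
  obtain ⟨k, hk⟩ : ∃ k, X.col k ≠ X₀.col k := by
    by_contra! h
    exact hne (Matrix.ext fun i k => congrFun (h k) i)
  rw [Finset.sum_comm, Finset.sum_comm (f := fun j k => |X j k|)]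
  refine Finset.sum_lt_sum (fun l _ => ?_) ⟨k, Finset.mem_univ k, hcol k _ (hfeas k) hk⟩
  by_cases hl : X.col l = X₀.col l
  · exact le_of_eq (congrArg (fun y : Fin n → ℝ => ∑ i, |y i|) hl.symm)
  · exact (hcol l _ (hfeas l) hl).le

/-- A problem where `ℓ_{1,1}` succeeds and `ℓ_{1,2}` fails: if every
1-sparse vector is uniquely recovered by basis pursuit and `x` has at
least `m + 1` nonzero entries, then `X0 = diag x` is the unique `ℓ_{1,1}`
minimizer subject to `AX = AX0`, but it is not an `ℓ_{1,2}` minimizer. -/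
theorem diag_recovered_by_l11_not_by_l12
    (m n : ℕ) (A : Matrix (Fin m) (Fin n) ℝ)
    (h1sparse : ∀ (j : Fin n) (t : ℝ), t ≠ 0 →
      ∀ x : Fin n → ℝ, A.mulVec x = A.mulVec (Pi.single j t) → x ≠ Pi.single j t →
        ∑ i, |(Pi.single j t : Fin n → ℝ) i| < ∑ i, |x i|)
    (x : Fin n → ℝ)
    (hx : m + 1 ≤ (Finset.univ.filter fun j => x j ≠ 0).card) :
    (∀ X : Matrix (Fin n) (Fin n) ℝ,
      A * X = A * Matrix.diagonal x → X ≠ Matrix.diagonal x →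
        ∑ j, ∑ k, |Matrix.diagonal x j k| < ∑ j, ∑ k, |X j k|) ∧
    ¬ (∀ X : Matrix (Fin n) (Fin n) ℝ, A * X = A * Matrix.diagonal x →
        ∑ j, l2norm (Matrix.diagonal x j) ≤ ∑ j, l2norm (X j)) := by
  refine ⟨sum_abs_lt_of_forall_col A _ fun k y hy hne => ?_, fun hmin => ?_⟩
  · have hk : (Matrix.diagonal x).col k = Pi.single k (x k) := by
      funext i
      by_cases h : i = k
      · subst h; simp
      · simp [h]
    rw [hk] at hy hne ⊢
    by_cases hxk : x k = 0
    · obtain ⟨i, hi⟩ := Function.ne_iff.mp hne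
      simp only [hxk, Pi.single_zero, Pi.zero_apply, abs_zero, Finset.sum_const_zero] at hi ⊢
      exact Finset.sum_pos' (fun _ _ => abs_nonneg _) ⟨i, Finset.mem_univ i, abs_pos.mpr hi⟩
    · exact h1sparse k (x k) hxk y hy hne
  · obtain ⟨v, hv, hsupp, hAv⟩ := exists_mulVec_eq_zero_supported A _ hx
    obtain ⟨X, hX, hlt⟩ := exists_sum_l2norm_lt_of_mulVec_eq_zero A x v hv
      (fun j hj => hsupp j (by simp [hj])) hAv
    exact (hmin X hX).not_gt hlt
end

section
/- There exist positive integers m, n, r, a real m×n matrix A, and matrices X0, X1 ∈ ℝ^{n×r} having the same row support and entrywise identical sign patterns (sign((X1)_{jk}) = sign((X0)_{jk}) for all j, k), such that X0 is the unique minimizer of ‖X‖_{1,2} over {X : AX = AX0} while X1 is not the unique minimizer of ‖X‖_{1,2} over {X : AX = AX1}. Hence recovery by ℓ_{1,2} minimization is not determined by the row support and sign pattern alone, but also depends on the magnitudes of the nonzero entries. -/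
open Matrix Finset

theorem l2norm_fin_two (v : Fin 2 → ℝ) : l2norm v = √(v 0 ^ 2 + v 1 ^ 2) := by
  simp [l2norm, Fin.sum_univ_two]

/-- Cauchy–Schwarz in the plane against a unit vector `(c, s)`. -/
theorem mul_add_mul_le_l2norm {c s : ℝ} (h : c ^ 2 + s ^ 2 = 1) (v : Fin 2 → ℝ) :
    c * v 0 + s * v 1 ≤ l2norm v := by
  rw [l2norm_fin_two]
  refine Real.le_sqrt_of_sq_le ?_
  have key : (c * v 0 + s * v 1) ^ 2 + (c * v 1 - s * v 0) ^ 2 = v 0 ^ 2 + v 1 ^ 2 := by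
    linear_combination (v 0 ^ 2 + v 1 ^ 2) * h
  nlinarith [sq_nonneg (c * v 1 - s * v 0)]

theorem l2norm_fin_two_eq {v : Fin 2 → ℝ} {a : ℝ} (ha : 0 ≤ a)
    (h : v 0 ^ 2 + v 1 ^ 2 = a ^ 2) : l2norm v = a := by
  rw [l2norm_fin_two, h, Real.sqrt_sq ha]

/-- Recovery by `ℓ_{1,2}` minimization is not determined by the row support
and sign pattern alone: there are matrices `X0`, `X1` with the same row
support and entrywise identical sign patterns such that `X0` is uniquely
recovered by `ℓ_{1,2}` while `X1` is not. -/
theorem l12_recovery_depends_on_magnitudes :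
    ∃ (m n r : ℕ) (A : Matrix (Fin m) (Fin n) ℝ)
      (X0 X1 : Matrix (Fin n) (Fin r) ℝ),
      0 < m ∧ 0 < n ∧ 0 < r ∧
      (∀ j, X0 j = 0 ↔ X1 j = 0) ∧
      (∀ j k, Real.sign (X1 j k) = Real.sign (X0 j k)) ∧
      (∀ X : Matrix (Fin n) (Fin r) ℝ, A * X = A * X0 → X ≠ X0 →
        ∑ j, l2norm (X0 j) < ∑ j, l2norm (X j)) ∧
      ¬ (∀ X : Matrix (Fin n) (Fin r) ℝ, A * X = A * X1 → X ≠ X1 →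
        ∑ j, l2norm (X1 j) < ∑ j, l2norm (X j)) := by
  refine ⟨2, 3, 2, !![1, -1, 0; 0, 1, -1], !![12, 5; -12, 5; 0, 0], !![3, 4; -3, 4; 0, 0],
    by norm_num, by norm_num, by norm_num, ?_, ?_, ?_, ?_⟩
  · intro j
    fin_cases j <;> simp [funext_iff, Fin.forall_fin_two]
  · intro j k
    fin_cases j <;> fin_cases k <;> simp [Real.sign_neg, Real.sign_of_pos]
  · intro X hX hne
    have hrow (i k) := congrFun (congrFun hX i) k
    have h00 := hrow 0 0
    have h01 := hrow 0 1
    have h10 := hrow 1 0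
    have h11 := hrow 1 1
    simp [Matrix.mul_apply, Fin.sum_univ_three] at h00 h01 h10 h11
    have e0 : l2norm (!![12, 5; -12, 5; 0, 0] 0 : Fin 2 → ℝ) = 13 :=
      l2norm_fin_two_eq (by norm_num) (by norm_num)
    have e1 : l2norm (!![12, 5; -12, 5; 0, 0] 1 : Fin 2 → ℝ) = 13 :=
      l2norm_fin_two_eq (by norm_num) (by norm_num)
    have e2 : l2norm (!![12, 5; -12, 5; 0, 0] 2 : Fin 2 → ℝ) = 0 :=
      l2norm_fin_two_eq le_rfl (by simp)
    have b0 := mul_add_mul_le_l2norm (c := 12 / 13) (s := 5 / 13) (by norm_num) (X 0)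
    have b1 := mul_add_mul_le_l2norm (c := -12 / 13) (s := 5 / 13) (by norm_num) (X 1)
    have b2 : -(10 / 13) * X 2 1 < l2norm (X 2) := by
      rw [l2norm_fin_two]
      refine Real.lt_sqrt_of_sq_lt ?_
      by_contra! hle
      have hq : X 2 1 = 0 := by
        apply pow_eq_zero_iff two_ne_zero |>.mp
        nlinarith [sq_nonneg (X 2 0), sq_nonneg (X 2 1)]
      have hp : X 2 0 = 0 := by
        apply pow_eq_zero_iff two_ne_zero |>.mp
        nlinarith [sq_nonneg (X 2 0), sq_nonneg (X 2 1)]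
      apply hne
      ext j k
      fin_cases j <;> fin_cases k <;> simp <;> linarith
    rw [Fin.sum_univ_three, Fin.sum_univ_three, e0, e1, e2]
    linarith
  · intro h
    have hlt := h !![3, 0; -3, 0; 0, -4]
      (by ext i k; fin_cases i <;> fin_cases k <;> simp [Matrix.mul_apply, Fin.sum_univ_three])
      (fun he => by simpa using congrFun (congrFun he 0) 1)
    have e0 : l2norm (!![3, 4; -3, 4; 0, 0] 0 : Fin 2 → ℝ) = 5 :=
      l2norm_fin_two_eq (by norm_num) (by norm_num)
    have e1 : l2norm (!![3, 4; -3, 4; 0, 0] 1 : Fin 2 → ℝ) = 5 :=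
      l2norm_fin_two_eq (by norm_num) (by norm_num)
    have e2 : l2norm (!![3, 4; -3, 4; 0, 0] 2 : Fin 2 → ℝ) = 0 :=
      l2norm_fin_two_eq le_rfl (by simp)
    have f0 : l2norm (!![3, 0; -3, 0; 0, -4] 0 : Fin 2 → ℝ) = 3 :=
      l2norm_fin_two_eq (by norm_num) (by norm_num)
    have f1 : l2norm (!![3, 0; -3, 0; 0, -4] 1 : Fin 2 → ℝ) = 3 :=
      l2norm_fin_two_eq (by norm_num) (by norm_num)
    have f2 : l2norm (!![3, 0; -3, 0; 0, -4] 2 : Fin 2 → ℝ) = 4 :=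
      l2norm_fin_two_eq (by norm_num) (by simp)
    rw [Fin.sum_univ_three, Fin.sum_univ_three, e0, e1, e2, f0, f1, f2] at hlt
    norm_num at hlt
end

section
/- Let n and d be positive integers and let v_1, …, v_d ∈ ℝ^n. Then the number of sign vectors ε ∈ {−1, 1}^n for which there exists x in the linear span of {v_1, …, v_d} with ε_i x_i > 0 for all i ∈ {1,…,n} is at most 2 · ∑_{i=0}^{d−1} binom(n−1, i). -/
open Finset

/-- Among more than `d` coordinates, the span of `d` vectors satisfies a nontrivial linear
relation. -/
lemma exists_relation_of_card_lt {n d : ℕ} (v : Fin d → (Fin n → ℝ)) (t : Finset (Fin n))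
    (ht : d < #t) :
    ∃ c : Fin n → ℝ, (∀ x ∈ Submodule.span ℝ (Set.range v), ∑ i ∈ t, c i * x i = 0) ∧
      ∃ i ∈ t, c i ≠ 0 := by
  have hdep : ¬ LinearIndepOn ℝ (fun (i : Fin n) (j : Fin d) => v j i) (t : Set (Fin n)) := by
    intro h
    have := LinearIndependent.fintype_card_le_finrank h
    simp at this
    omega
  rw [linearIndepOn_finset_iff] at hdep
  push Not at hdep
  obtain ⟨c, hc, i, hi, hci⟩ := hdep
  refine ⟨c, fun x hx => ?_, i, hi, hci⟩
  induction hx using Submodule.span_induction with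
  | mem x hx =>
    obtain ⟨j, rfl⟩ := hx
    simpa using congrFun hc j
  | zero => simp
  | add x y _ _ hx hy => simp [mul_add, sum_add_distrib, hx, hy]
  | smul a x _ hx =>
    simp only [Pi.smul_apply, smul_eq_mul, mul_left_comm _ a, ← mul_sum, hx, mul_zero]

open Classical in
/-- The sign patterns of the last `m` coordinates of vectors of `W` whose first coordinate is
positive, each encoded by its set of positive coordinates. -/
noncomputable def positivePatterns {m : ℕ} (W : Submodule ℝ (Fin (m + 1) → ℝ)) :
    Finset (Finset (Fin m)) :=
  {T | ∃ x ∈ W, 0 < x 0 ∧ ∀ i, if i ∈ T then 0 < x (Fin.succ i) else x (Fin.succ i) < 0}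

lemma card_lt_of_shatters_positivePatterns {m d : ℕ} (v : Fin d → (Fin (m + 1) → ℝ))
    {s : Finset (Fin m)} (hs : (positivePatterns (Submodule.span ℝ (Set.range v))).Shatters s) :
    #s < d := by
  by_contra! hds
  set W := Submodule.span ℝ (Set.range v)
  obtain ⟨c, hc, hne, h0⟩ : ∃ c : Fin (m + 1) → ℝ,
      (∀ x ∈ W, ∑ i ∈ insert 0 (s.map (Fin.succEmb m)), c i * x i = 0) ∧
      (∃ i ∈ insert 0 (s.map (Fin.succEmb m)), c i ≠ 0) ∧ 0 ≤ c 0 := by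
    obtain ⟨c, hc, i, hi, hne⟩ := exists_relation_of_card_lt v
      (insert 0 (s.map (Fin.succEmb m))) (by
        rw [card_insert_of_notMem (by simp), card_map]; omega)
    rcases le_total 0 (c 0) with h | h
    · exact ⟨c, hc, ⟨i, hi, hne⟩, h⟩
    · refine ⟨-c, fun x hx => ?_, ⟨i, hi, by simpa using hne⟩, by simpa using h⟩
      simpa only [Pi.neg_apply, neg_mul, sum_neg_distrib, neg_eq_zero] using hc x hx
  obtain ⟨T, hT, hsT⟩ := hs (filter_subset (fun i => 0 < c (Fin.succ i)) s)
  simp only [positivePatterns, mem_filter, mem_univ, true_and] at hT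
  obtain ⟨x, hxW, hx0, hx⟩ := hT
  have hmem : ∀ i ∈ s, (i ∈ T ↔ 0 < c (Fin.succ i)) := fun i hi => by
    simpa [hi] using Finset.ext_iff.mp hsT i
  have hnonneg : ∀ i ∈ insert 0 (s.map (Fin.succEmb m)), 0 ≤ c i * x i := by
    simp only [forall_mem_insert, forall_mem_map, Fin.coe_succEmb]
    refine ⟨mul_nonneg h0 hx0.le, fun i hi => ?_⟩
    have hxi := hx i
    split_ifs at hxi with h
    · exact mul_nonneg ((hmem i hi).1 h).le hxi.le
    · exact mul_nonneg_of_nonpos_of_nonpos (not_lt.1 (mt (hmem i hi).2 h)) hxi.le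
  obtain ⟨i, hi, hci⟩ := hne
  have hxi : x i ≠ 0 := by
    refine Fin.cases hx0.ne' (fun j => ?_) i
    have hxj := hx j
    split_ifs at hxj
    exacts [hxj.ne', hxj.ne]
  exact mul_ne_zero hci hxi ((sum_eq_zero_iff_of_nonneg hnonneg).1 (hc x hxW) i hi)

lemma card_positivePatterns_le {m d : ℕ} (hd : 0 < d) (v : Fin d → (Fin (m + 1) → ℝ)) :
    #(positivePatterns (Submodule.span ℝ (Set.range v))) ≤ ∑ i ∈ range d, m.choose i := by
  refine (card_le_card_shatterer _).trans (card_shatterer_le_sum_vcDim.trans ?_)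
  rw [Fintype.card_fin]
  refine sum_le_sum_of_subset fun k hk => ?_
  rw [mem_Iic] at hk
  rw [mem_range]
  refine hk.trans_lt ((Finset.sup_lt_iff hd).2 fun s hs => ?_)
  exact card_lt_of_shatters_positivePatterns v (mem_shatterer.1 hs)

/-- The span of `d` vectors in `ℝ^n` properly intersects at most
`2 * ∑_{i=0}^{d-1} C(n-1, i)` open orthants, i.e. realizes at most that many
full sign patterns. -/
theorem orthant_count_le
    (n d : ℕ) (hn : 0 < n) (hd : 0 < d) (v : Fin d → (Fin n → ℝ)) :
    {ε : Fin n → ℝ | (∀ i, ε i = 1 ∨ ε i = -1) ∧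
        ∃ x ∈ Submodule.span ℝ (Set.range v), ∀ i, 0 < ε i * x i}.ncard
      ≤ 2 * ∑ i ∈ Finset.range d, (n - 1).choose i := by
  classical
  obtain ⟨m, rfl⟩ : ∃ m, n = m + 1 := ⟨n - 1, by omega⟩
  set W := Submodule.span ℝ (Set.range v)
  let decode : ℝ × Finset (Fin m) → Fin (m + 1) → ℝ :=
    fun p => Fin.cons p.1 fun i => if i ∈ p.2 then p.1 else -p.1
  have hsub : {ε : Fin (m + 1) → ℝ | (∀ i, ε i = 1 ∨ ε i = -1) ∧
      ∃ x ∈ W, ∀ i, 0 < ε i * x i} ⊆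
      ((({1, -1} : Finset ℝ) ×ˢ positivePatterns W).image decode : Finset _) := by
    rintro ε ⟨hε, x, hxW, hx⟩
    rw [mem_coe, mem_image]
    refine ⟨(ε 0, univ.filter fun i => ε (Fin.succ i) = ε 0), ?_, ?_⟩
    · simp only [mem_product, mem_insert, mem_singleton, positivePatterns, mem_filter, mem_univ,
        true_and]
      refine ⟨hε 0, ε 0 • x, W.smul_mem _ hxW, hx 0, fun i => ?_⟩
      have hxi := hx i.succ
      simp only [Pi.smul_apply, smul_eq_mul]
      split_ifs with h
      · rwa [← h]
      · have : ε 0 = -ε i.succ := by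
          rcases hε 0 with h0 | h0 <;> rcases hε i.succ with h1 | h1 <;> simp_all
        rw [this]
        linarith
    · funext i
      refine Fin.cases rfl (fun i => ?_) i
      simp only [decode, Fin.cons_succ, mem_filter, mem_univ, true_and]
      rcases hε 0 with h0 | h0 <;> rcases hε i.succ with h1 | h1 <;> norm_num [h0, h1]
  calc _ ≤ _ := Set.ncard_le_ncard hsub (finite_toSet _)
    _ ≤ #(({1, -1} : Finset ℝ) ×ˢ positivePatterns W) := by
      rw [Set.ncard_coe_finset]
      exact card_image_le
    _ ≤ 2 * ∑ i ∈ range d, m.choose i := by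
      rw [card_product]
      exact Nat.mul_le_mul card_le_two (card_positivePatterns_le hd v)
end

section
/- Let C(n,d) denote the maximum, over all choices of d vectors v_1,…,v_d ∈ ℝ^n, of the number of sign vectors ε ∈ {−1,1}^n for which some x in the linear span of {v_1,…,v_d} satisfies ε_i x_i > 0 for all i, with the convention C(n,0) = 0. Then for all integers n ≥ 2 and d ≥ 1, C(n,d) = C(n−1, d−1) + C(n−1, d). -/
open Finset

/-- The number of open orthants of `ℝ^n` (equivalently, full sign patterns)
properly intersected by the linear span of the vectors `v 0, …, v (d-1)`. -/
noncomputable def orthantCount (n d : ℕ) (v : Fin d → (Fin n → ℝ)) : ℕ :=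
  {ε : Fin n → ℝ | (∀ i, ε i = 1 ∨ ε i = -1) ∧
      ∃ x ∈ Submodule.span ℝ (Set.range v), ∀ i, 0 < ε i * x i}.ncard

/-- `C n d`: the maximum number of open orthants of `ℝ^n` intersected by the
linear span of `d` vectors, with the convention `C n 0 = 0`. -/
noncomputable def maxOrthantCount (n d : ℕ) : ℕ :=
  if d = 0 then 0
  else sSup {c : ℕ | ∃ v : Fin d → (Fin n → ℝ), c = orthantCount n d v}

open Polynomial Topology

/-- The sign vectors of the open orthants met by the subspace `W`. -/
def orthantSigns {n : ℕ} (W : Submodule ℝ (Fin n → ℝ)) : Set (Fin n → ℝ) :=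
  {ε | (∀ i, ε i = 1 ∨ ε i = -1) ∧ ∃ x ∈ W, ∀ i, 0 < ε i * x i}

lemma finite_signVectors (n : ℕ) : {ε : Fin n → ℝ | ∀ i, ε i = 1 ∨ ε i = -1}.Finite := by
  have h := Set.Finite.pi (t := fun _ : Fin n => ({1, -1} : Set ℝ)) fun _ => Set.toFinite _
  exact h.subset fun ε hε i _ => hε i

lemma finite_orthantSigns {n : ℕ} (W : Submodule ℝ (Fin n → ℝ)) : (orthantSigns W).Finite :=
  (finite_signVectors n).subset fun _ hε => hε.1

lemma bddAbove_orthantCount (n d : ℕ) :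
    BddAbove {c : ℕ | ∃ v : Fin d → (Fin n → ℝ), c = orthantCount n d v} := by
  refine ⟨{ε : Fin n → ℝ | ∀ i, ε i = 1 ∨ ε i = -1}.ncard, ?_⟩
  rintro _ ⟨v, rfl⟩
  exact Set.ncard_le_ncard (fun _ hε => hε.1) (finite_signVectors n)

lemma exists_span_range_eq {n d : ℕ} {W : Submodule ℝ (Fin n → ℝ)}
    (hW : Module.finrank ℝ W ≤ d) :
    ∃ v : Fin d → (Fin n → ℝ), Submodule.span ℝ (Set.range v) = W := by
  let b := Module.finBasis ℝ W
  refine ⟨fun i => if h : (i : ℕ) < Module.finrank ℝ W then b ⟨i, h⟩ else 0,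
    le_antisymm ?_ ?_⟩
  · rw [Submodule.span_le]
    rintro _ ⟨i, rfl⟩
    dsimp only
    split_ifs
    · exact Subtype.property _
    · exact W.zero_mem
  · intro x hx
    have hsum := congrArg Subtype.val (b.sum_repr ⟨x, hx⟩)
    rw [← show _ = x from hsum, Submodule.coe_sum]
    refine Submodule.sum_mem _ fun i _ => Submodule.smul_mem _ _ (Submodule.subset_span ?_)
    exact ⟨⟨i, i.2.trans_le hW⟩, by simp⟩

lemma ncard_orthantSigns_le_maxOrthantCount {n d : ℕ} (hn : n ≠ 0)
    {W : Submodule ℝ (Fin n → ℝ)} (hW : Module.finrank ℝ W ≤ d) :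
    (orthantSigns W).ncard ≤ maxOrthantCount n d := by
  rcases eq_or_ne d 0 with rfl | hd
  · have hbot : W = ⊥ := Submodule.finrank_eq_zero.mp (Nat.le_zero.mp hW)
    have hempty : orthantSigns W = ∅ := by
      refine Set.eq_empty_of_forall_notMem ?_
      rintro ε ⟨-, x, hx, h⟩
      rw [hbot, Submodule.mem_bot] at hx
      simpa [hx] using h ⟨0, Nat.pos_of_ne_zero hn⟩
    simp [hempty]
  · obtain ⟨v, rfl⟩ := exists_span_range_eq hW
    rw [maxOrthantCount, if_neg hd]
    exact le_csSup (bddAbove_orthantCount n d) ⟨v, rfl⟩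

lemma maxOrthantCount_le {n d c : ℕ}
    (h : ∀ W : Submodule ℝ (Fin n → ℝ), Module.finrank ℝ W ≤ d → (orthantSigns W).ncard ≤ c) :
    maxOrthantCount n d ≤ c := by
  rw [maxOrthantCount]
  split_ifs
  · exact Nat.zero_le c
  · refine csSup_le ⟨_, fun _ => 0, rfl⟩ ?_
    rintro _ ⟨v, rfl⟩
    exact h _ ((finrank_range_le_card v).trans_eq (Fintype.card_fin d))

/-- The projection of `W` that forgets the last coordinate. -/
abbrev projInit {n : ℕ} (W : Submodule ℝ (Fin (n + 1) → ℝ)) : Submodule ℝ (Fin n → ℝ) :=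
  W.map (LinearMap.funLeft ℝ ℝ Fin.castSucc)

/-- The hyperplane where the last coordinate vanishes. -/
abbrev lastHyperplane (n : ℕ) : Submodule ℝ (Fin (n + 1) → ℝ) :=
  LinearMap.ker (LinearMap.proj (Fin.last n) : (Fin (n + 1) → ℝ) →ₗ[ℝ] ℝ)

/-- The sign vectors that become an element of `orthantSigns W` when `s` is appended. -/
def extendableSigns {n : ℕ} (W : Submodule ℝ (Fin (n + 1) → ℝ)) (s : ℝ) : Set (Fin n → ℝ) :=
  {ε | (∀ i, ε i = 1 ∨ ε i = -1) ∧
    ∃ x ∈ W, (∀ i : Fin n, 0 < ε i * x i.castSucc) ∧ 0 < s * x (Fin.last n)}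

lemma finite_extendableSigns {n : ℕ} (W : Submodule ℝ (Fin (n + 1) → ℝ)) (s : ℝ) :
    (extendableSigns W s).Finite :=
  (finite_signVectors n).subset fun _ hε => hε.1

lemma orthantSigns_eq_union_snoc {n : ℕ} (W : Submodule ℝ (Fin (n + 1) → ℝ)) :
    orthantSigns W =
      (fun ε : Fin n → ℝ => (Fin.snoc ε (1 : ℝ) : Fin (n + 1) → ℝ)) '' extendableSigns W 1 ∪
      (fun ε : Fin n → ℝ => (Fin.snoc ε (-1 : ℝ) : Fin (n + 1) → ℝ)) ''
        extendableSigns W (-1) := by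
  ext ε
  constructor
  · rintro ⟨hε, x, hx, hpos⟩
    have hinit : ∀ s, ε (Fin.last n) = s → Fin.init ε ∈ extendableSigns W s := by
      rintro s rfl
      exact ⟨fun i => hε _, x, hx, fun i => hpos _, hpos _⟩
    rcases hε (Fin.last n) with h | h
    · exact Or.inl ⟨Fin.init ε, hinit _ h, by dsimp only; rw [← h, Fin.snoc_init_self]⟩
    · exact Or.inr ⟨Fin.init ε, hinit _ h, by dsimp only; rw [← h, Fin.snoc_init_self]⟩
  · rintro (⟨ε, ⟨hε, x, hx, hpos, hlast⟩, rfl⟩ | ⟨ε, ⟨hε, x, hx, hpos, hlast⟩, rfl⟩)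
    all_goals
      refine ⟨fun i => ?_, x, hx, fun i => ?_⟩
      · refine Fin.lastCases ?_ (fun j => ?_) i
        · simp
        · simpa using hε j
      · refine Fin.lastCases ?_ (fun j => ?_) i
        · simpa using hlast
        · simpa using hpos j

lemma ncard_orthantSigns_eq_add {n : ℕ} (W : Submodule ℝ (Fin (n + 1) → ℝ)) :
    (orthantSigns W).ncard =
      (extendableSigns W 1).ncard + (extendableSigns W (-1)).ncard := by
  have hinj : ∀ s : ℝ,
      Function.Injective fun ε : Fin n → ℝ => (Fin.snoc ε s : Fin (n + 1) → ℝ) := by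
    intro s ε ε' h
    simpa using congrArg Fin.init h
  rw [orthantSigns_eq_union_snoc, Set.ncard_union_eq _ ((finite_extendableSigns W 1).image _)
    ((finite_extendableSigns W (-1)).image _), Set.ncard_image_of_injective _ (hinj 1),
    Set.ncard_image_of_injective _ (hinj (-1))]
  rw [Set.disjoint_left]
  rintro _ ⟨ε, -, rfl⟩ ⟨ε', -, h⟩
  have := congrFun h (Fin.last n)
  norm_num at this

/-- A vector of `W` with vanishing last coordinate can be perturbed within `W`, so that the last
coordinate gets any prescribed sign. -/
lemma mem_extendableSigns_of_last_eq_zero {n : ℕ} {W : Submodule ℝ (Fin (n + 1) → ℝ)}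
    (hW : ¬ W ≤ lastHyperplane n) {ε : Fin n → ℝ} (hε : ∀ i, ε i = 1 ∨ ε i = -1)
    {z : Fin (n + 1) → ℝ} (hz : z ∈ W) (hpos : ∀ i : Fin n, 0 < ε i * z i.castSucc)
    (hlast : z (Fin.last n) = 0) {s : ℝ} (hs : s ≠ 0) : ε ∈ extendableSigns W s := by
  obtain ⟨x, hx, hx0⟩ := SetLike.not_le_iff_exists.mp hW
  replace hx0 : x (Fin.last n) ≠ 0 := hx0
  have hev : ∀ᶠ t : ℝ in 𝓝 0,
      ∀ i : Fin n, 0 < ε i * (z i.castSucc + t * (s * x (Fin.last n)) * x i.castSucc) := by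
    rw [Filter.eventually_all]
    intro i
    have hcont : Continuous fun t : ℝ =>
        ε i * (z i.castSucc + t * (s * x (Fin.last n)) * x i.castSucc) := by fun_prop
    exact hcont.continuousAt.eventually_const_lt (by simpa using hpos i)
  obtain ⟨t, ht, ht0⟩ := ((hev.filter_mono nhdsWithin_le_nhds).and
    (self_mem_nhdsWithin : Set.Ioi (0 : ℝ) ∈ 𝓝[>] 0)).exists
  refine ⟨hε, z + (t * (s * x (Fin.last n))) • x, W.add_mem hz (W.smul_mem _ hx),
    fun i => by simpa using ht i, ?_⟩
  have hsq : 0 < t * (s * x (Fin.last n)) ^ 2 :=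
    mul_pos ht0 (by positivity)
  simp only [Pi.add_apply, Pi.smul_apply, smul_eq_mul, hlast]
  linarith

lemma extendableSigns_union {n : ℕ} {W : Submodule ℝ (Fin (n + 1) → ℝ)}
    (hW : ¬ W ≤ lastHyperplane n) :
    extendableSigns W 1 ∪ extendableSigns W (-1) = orthantSigns (projInit W) := by
  ext ε
  constructor
  · rintro (⟨hε, x, hx, hpos, -⟩ | ⟨hε, x, hx, hpos, -⟩) <;>
      exact ⟨hε, _, Submodule.mem_map_of_mem hx, hpos⟩
  · rintro ⟨hε, _, ⟨x, hx, rfl⟩, hpos⟩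
    rcases lt_trichotomy (x (Fin.last n)) 0 with h | h | h
    · exact Or.inr ⟨hε, x, hx, hpos, by linarith⟩
    · exact Or.inl (mem_extendableSigns_of_last_eq_zero hW hε hx hpos h one_ne_zero)
    · exact Or.inl ⟨hε, x, hx, hpos, by linarith⟩

lemma extendableSigns_inter {n : ℕ} {W : Submodule ℝ (Fin (n + 1) → ℝ)}
    (hW : ¬ W ≤ lastHyperplane n) :
    extendableSigns W 1 ∩ extendableSigns W (-1) =
      orthantSigns (projInit (W ⊓ lastHyperplane n)) := by
  ext ε
  constructor
  · rintro ⟨⟨hε, x, hx, hxpos, hxlast⟩, ⟨-, y, hy, hypos, hylast⟩⟩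
    have hx1 : 0 < x (Fin.last n) := by linarith
    have hy1 : 0 < -y (Fin.last n) := by linarith
    refine ⟨hε, _, ⟨(-y (Fin.last n)) • x + x (Fin.last n) • y, ⟨?_, ?_⟩, rfl⟩, fun i => ?_⟩
    · exact W.add_mem (W.smul_mem _ hx) (W.smul_mem _ hy)
    · simp only [SetLike.mem_coe, LinearMap.mem_ker, LinearMap.proj_apply, Pi.add_apply,
        Pi.smul_apply, smul_eq_mul]
      ring
    · have h₁ := mul_pos hy1 (hxpos i)
      have h₂ := mul_pos hx1 (hypos i)
      simp only [LinearMap.funLeft_apply, Pi.add_apply, Pi.smul_apply, smul_eq_mul]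
      linarith
  · rintro ⟨hε, _, ⟨x, ⟨hx, hlast⟩, rfl⟩, hpos⟩
    exact ⟨mem_extendableSigns_of_last_eq_zero hW hε hx hpos hlast one_ne_zero,
      mem_extendableSigns_of_last_eq_zero hW hε hx hpos hlast (by norm_num)⟩

/-- Deletion–restriction for the number of orthants met by a subspace. -/
lemma ncard_orthantSigns_projInit_add {n : ℕ} {W : Submodule ℝ (Fin (n + 1) → ℝ)}
    (hW : ¬ W ≤ lastHyperplane n) :
    (orthantSigns W).ncard = (orthantSigns (projInit (W ⊓ lastHyperplane n))).ncard +
      (orthantSigns (projInit W)).ncard := by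
  rw [ncard_orthantSigns_eq_add, ← extendableSigns_union hW, ← extendableSigns_inter hW,
    ← Set.ncard_union_add_ncard_inter _ _ (finite_extendableSigns W 1)
      (finite_extendableSigns W (-1)), add_comm]

lemma maxOrthantCount_succ_succ_le {n : ℕ} (d : ℕ) (hn : n ≠ 0) :
    maxOrthantCount (n + 1) (d + 1) ≤ maxOrthantCount n d + maxOrthantCount n (d + 1) := by
  refine maxOrthantCount_le fun W hfin => ?_
  by_cases hW : W ≤ lastHyperplane n
  · have hempty : orthantSigns W = ∅ := by
      refine Set.eq_empty_of_forall_notMem ?_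
      rintro ε ⟨-, x, hx, h⟩
      have hx0 : x (Fin.last n) = 0 := hW hx
      simpa [hx0] using h (Fin.last n)
    simp [hempty]
  · rw [ncard_orthantSigns_projInit_add hW]
    refine add_le_add (ncard_orthantSigns_le_maxOrthantCount hn ?_)
      (ncard_orthantSigns_le_maxOrthantCount hn ((Submodule.finrank_map_le _ _).trans hfin))
    have hlt := Submodule.finrank_lt_finrank_of_lt (inf_lt_left.mpr hW)
    exact (Submodule.finrank_map_le _ _).trans (by omega)

/-- The values at `0, …, n - 1` of the real polynomials of degree less than `d`. -/
noncomputable def polyValues (n d : ℕ) : Submodule ℝ (Fin n → ℝ) :=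
  (degreeLT ℝ d).map (LinearMap.pi fun i : Fin n => leval (i : ℝ))

lemma mem_polyValues {n d : ℕ} {p : ℝ[X]} (hp : p ∈ degreeLT ℝ d) :
    (fun i : Fin n => p.eval (i : ℝ)) ∈ polyValues n d :=
  ⟨p, hp, rfl⟩

lemma const_mem_polyValues (n d : ℕ) (c : ℝ) : (fun _ => c) ∈ polyValues n (d + 1) := by
  have hC : C c ∈ degreeLT ℝ (d + 1) :=
    mem_degreeLT.mpr (degree_C_le.trans_lt (by exact_mod_cast Nat.succ_pos d))
  simpa using mem_polyValues (n := n) hC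

lemma finrank_polyValues_le (n d : ℕ) : Module.finrank ℝ (polyValues n d) ≤ d := by
  have : Module.Finite ℝ (degreeLT ℝ d) := Module.Finite.equiv (degreeLTEquiv ℝ d).symm
  refine (Submodule.finrank_map_le _ _).trans_eq ?_
  rw [(degreeLTEquiv ℝ d).finrank_eq, Module.finrank_fin_fun]

lemma ncard_orthantSigns_polyValues_add_le (n d : ℕ) :
    (orthantSigns (polyValues n d)).ncard + (orthantSigns (polyValues n (d + 1))).ncard ≤
      (orthantSigns (polyValues (n + 1) (d + 1))).ncard := by
  have hW : ¬ polyValues (n + 1) (d + 1) ≤ lastHyperplane n := fun h =>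
    one_ne_zero (α := ℝ) (h (const_mem_polyValues (n + 1) d 1))
  rw [ncard_orthantSigns_projInit_add hW]
  refine add_le_add (Set.ncard_le_ncard ?_ (finite_orthantSigns _))
    (Set.ncard_le_ncard ?_ (finite_orthantSigns _))
  · rintro ε ⟨hε, _, ⟨p, hp, rfl⟩, hpos⟩
    have hq : p * (C (n : ℝ) - X) ∈ degreeLT ℝ (d + 1) := by
      rw [SetLike.mem_coe, mem_degreeLT] at hp
      rw [mem_degreeLT]
      rcases eq_or_ne p 0 with rfl | hp0
      · simp
      have hX : degree (C (n : ℝ) - X) = 1 := by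
        rw [← degree_neg, neg_sub, degree_X_sub_C]
      rw [degree_mul, hX, Nat.cast_add, Nat.cast_one]
      rw [degree_eq_natDegree hp0] at hp ⊢
      exact_mod_cast Nat.add_lt_add_right (by exact_mod_cast hp) 1
    refine ⟨hε, _, Submodule.mem_map_of_mem ⟨mem_polyValues hq, ?_⟩, fun i => ?_⟩
    · simp
    · have hi : (0 : ℝ) < n - i := sub_pos.mpr (by exact_mod_cast i.2)
      have := mul_pos (hpos i) hi
      simpa [mul_assoc] using this
  · rintro ε ⟨hε, _, ⟨p, hp, rfl⟩, hpos⟩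
    exact ⟨hε, _, Submodule.mem_map_of_mem (mem_polyValues hp), hpos⟩

lemma maxOrthantCount_one_le (d : ℕ) :
    maxOrthantCount 1 (d + 1) ≤ (orthantSigns (polyValues 1 (d + 1))).ncard := by
  refine maxOrthantCount_le fun W _ => Set.ncard_le_ncard ?_ (finite_orthantSigns _)
  rintro ε ⟨hε, -⟩
  refine ⟨hε, _, const_mem_polyValues 1 d (ε 0), fun i => ?_⟩
  rw [Subsingleton.elim i 0]
  rcases hε 0 with h | h <;> norm_num [h]

/-- Polynomials of degree less than `d` meet the maximal number of orthants. -/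
lemma maxOrthantCount_le_polyValues (n d : ℕ) :
    maxOrthantCount (n + 1) d ≤ (orthantSigns (polyValues (n + 1) d)).ncard := by
  induction n generalizing d with
  | zero =>
    cases d with
    | zero => simp [maxOrthantCount]
    | succ d => exact maxOrthantCount_one_le d
  | succ n ih =>
    cases d with
    | zero => simp [maxOrthantCount]
    | succ d =>
      exact (maxOrthantCount_succ_succ_le d n.succ_ne_zero).trans
        ((add_le_add (ih d) (ih (d + 1))).trans (ncard_orthantSigns_polyValues_add_le (n + 1) d))

/-- The Pascal-type recurrence `C(n,d) = C(n-1,d-1) + C(n-1,d)`. -/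
theorem maxOrthantCount_recurrence (n d : ℕ) (hn : 2 ≤ n) (hd : 1 ≤ d) :
    maxOrthantCount n d
      = maxOrthantCount (n - 1) (d - 1) + maxOrthantCount (n - 1) d := by
  obtain ⟨n, rfl⟩ := Nat.exists_eq_add_of_le' hn
  obtain ⟨d, rfl⟩ := Nat.exists_eq_add_of_le' hd
  refine le_antisymm (maxOrthantCount_succ_succ_le d n.succ_ne_zero) ?_
  calc maxOrthantCount (n + 1) d + maxOrthantCount (n + 1) (d + 1)
      ≤ (orthantSigns (polyValues (n + 1) d)).ncard +
          (orthantSigns (polyValues (n + 1) (d + 1))).ncard :=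
        add_le_add (maxOrthantCount_le_polyValues n d) (maxOrthantCount_le_polyValues n (d + 1))
    _ ≤ (orthantSigns (polyValues (n + 2) (d + 1))).ncard :=
        ncard_orthantSigns_polyValues_add_le (n + 1) d
    _ ≤ maxOrthantCount (n + 2) (d + 1) :=
        ncard_orthantSigns_le_maxOrthantCount (by omega) (finrank_polyValues_le _ _)
end
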